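/- In the setting of the inverse function theorem in a cone (ŵ holomorphic on the cone K with ŵ(z)→0, ŵ'(z)→c≠0 as z→0), for any strict subcone K' = {re^{iτ} : 0<r<r₀, τ₁' < τ < τ₂' } with τ₁ < τ₁' < τ₂' < τ₂, there is a neighborhood V of 0 such that c·(K' ∩ V) ⊆ ŵ(K ∩ U), i.e. the image of ŵ covers a scaled copy of every strict subcone near 0. -/

import Mathlib

open Filter Topology

/-- The open circular sector of radius `r₀` and angles between `a` and `b`, with apex `0`. -/
def sector (r₀ a b : ℝ) : Set ℂ :=
  {z : ℂ | ∃ r τ : ℝ, 0 < r ∧ r < r₀ ∧ a < τ ∧ τ < b ∧ z = (r : ℂ) * Complex.exp (τ * Complex.I)}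

lemma norm_ofReal_mul_exp_mul_I {r : ℝ} (hr : 0 < r) (τ : ℝ) :
    ‖(r : ℂ) * Complex.exp (τ * Complex.I)‖ = r := by
  rw [norm_mul, Complex.norm_exp_ofReal_mul_I, Complex.norm_real, Real.norm_of_nonneg hr.le, mul_one]

/-- A chord of the unit circle is comparable to its arc, for arcs bounded away from `2π`. -/
lemma exists_mul_abs_sub_le_norm_exp_sub_exp {L : ℝ} (hL : 0 < L) (hL' : L < 2 * Real.pi) :
    ∃ s > 0, ∀ a b : ℝ, |a - b| ≤ L →
      s * |a - b| ≤ ‖Complex.exp (a * Complex.I) - Complex.exp (b * Complex.I)‖ := by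
  have hpos : 0 < Real.sin (L / 2) := Real.sin_pos_of_pos_of_lt_pi (by linarith) (by linarith)
  refine ⟨2 * Real.sin (L / 2) / L, by positivity, fun a b hab => ?_⟩
  have hnorm : ‖Complex.exp (a * Complex.I) - Complex.exp (b * Complex.I)‖
      = 2 * |Real.sin ((a - b) / 2)| := by
    have h : Complex.exp (a * Complex.I) - Complex.exp (b * Complex.I)
        = Complex.exp (b * Complex.I) * (Complex.exp (Complex.I * ((a - b : ℝ) : ℂ)) - 1) := by
      rw [mul_sub, ← Complex.exp_add, mul_one]
      push_cast
      ring_nf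
    rw [h, norm_mul, Complex.norm_exp_ofReal_mul_I, one_mul, Complex.norm_exp_I_mul_ofReal_sub_one,
      norm_mul, Real.norm_eq_abs, Real.norm_eq_abs, abs_two]
  have habs : |Real.sin ((a - b) / 2)| = Real.sin (|a - b| / 2) := by
    have h := Real.abs_sin_eq_sin_abs_of_abs_le_pi (x := (a - b) / 2)
      (by rw [abs_div, abs_two]; linarith)
    rw [h, abs_div, abs_two]
  have ht : |a - b| / L ≤ 1 := (div_le_one hL).2 hab
  have hconc := strictConcaveOn_sin_Icc.concaveOn.2
    (⟨le_rfl, Real.pi_pos.le⟩ : (0 : ℝ) ∈ Set.Icc 0 Real.pi)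
    (⟨by linarith, by linarith⟩ : L / 2 ∈ Set.Icc 0 Real.pi)
    (sub_nonneg.2 ht) (by positivity : 0 ≤ |a - b| / L) (by ring)
  simp only [smul_eq_mul, Real.sin_zero, mul_zero, zero_add] at hconc
  rw [hnorm, habs]
  have harg : |a - b| / L * (L / 2) = |a - b| / 2 := by field_simp
  rw [harg] at hconc
  calc 2 * Real.sin (L / 2) / L * |a - b| = 2 * (|a - b| / L * Real.sin (L / 2)) := by ring
    _ ≤ _ := by linarith

/-- A point close to `r * exp (τ * I)`, relative to `r`, has an argument close to `τ`. -/
lemma exists_polar_of_norm_sub_le {δ : ℝ} (hδ : 0 < δ) :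
    ∃ η > 0, η < 1 ∧ ∀ (r τ : ℝ) (z : ℂ), 0 < r →
      ‖z - (r : ℂ) * Complex.exp (τ * Complex.I)‖ ≤ η * r →
      ∃ τ' : ℝ, 0 < ‖z‖ ∧ |τ' - τ| < δ ∧ z = (‖z‖ : ℂ) * Complex.exp (τ' * Complex.I) := by
  have hcont : ContinuousAt Complex.arg 1 := Complex.continuousAt_arg (by simp)
  obtain ⟨ε, hε, h⟩ := Metric.continuousAt_iff.1 hcont δ hδ
  have hη : 0 < min (ε / 2) (1 / 2) := by positivity
  refine ⟨min (ε / 2) (1 / 2), hη, by linarith [min_le_right (ε / 2) (1 / 2 : ℝ)],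
    fun r τ z hr hz => ?_⟩
  set p : ℂ := (r : ℂ) * Complex.exp (τ * Complex.I) with hp
  have hpn : ‖p‖ = r := norm_ofReal_mul_exp_mul_I hr τ
  have hp0 : p ≠ 0 := norm_pos_iff.1 (hpn ▸ hr)
  have hq : ‖z / p - 1‖ ≤ min (ε / 2) (1 / 2) := by
    rw [div_sub_one hp0, norm_div, hpn, div_le_iff₀ hr]
    exact hz
  have hz0 : 0 < ‖z‖ := by
    rw [norm_pos_iff]
    rintro rfl
    rw [zero_div, zero_sub, norm_neg, norm_one] at hq
    linarith [min_le_right (ε / 2) (1 / 2 : ℝ)]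
  refine ⟨τ + Complex.arg (z / p), hz0, ?_, ?_⟩
  · have := h (x := z / p) (by
      rw [dist_eq_norm]; linarith [min_le_left (ε / 2) (1 / 2 : ℝ)])
    rwa [Complex.arg_one, Real.dist_eq, sub_zero, ← add_sub_cancel_left τ (Complex.arg _)] at this
  · have h1 := Complex.norm_mul_exp_arg_mul_I (z / p)
    have hr' : (r : ℂ) ≠ 0 := by exact_mod_cast hr.ne'
    rw [norm_div, hpn] at h1
    push_cast at h1 ⊢
    rw [add_mul, Complex.exp_add]
    calc z = p * (z / p) := by field_simp
      _ = p * (‖z‖ / r * Complex.exp (Complex.arg (z / p) * Complex.I)) := by rw [h1]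
      _ = _ := by
        rw [hp]
        field_simp

lemma isOpen_sector (r₀ a b : ℝ) : IsOpen (sector r₀ a b) := by
  rw [Metric.isOpen_iff]
  rintro _ ⟨r, τ, hr, hrr, ha, hb, rfl⟩
  obtain ⟨η, hη, -, h⟩ := exists_polar_of_norm_sub_le
    (lt_min (sub_pos.2 ha) (sub_pos.2 hb))
  refine ⟨min (η * r) (r₀ - r), lt_min (by positivity) (sub_pos.2 hrr), fun z hz => ?_⟩
  rw [Metric.mem_ball, dist_eq_norm, lt_min_iff] at hz
  obtain ⟨τ', hz0, hτ', hzeq⟩ := h r τ z hr hz.1.le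
  rw [lt_min_iff, abs_lt, abs_lt] at hτ'
  refine ⟨‖z‖, τ', hz0, ?_, by linarith [hτ'.1.1], by linarith [hτ'.2.2], hzeq⟩
  have := norm_sub_norm_le z ((r : ℂ) * Complex.exp (τ * Complex.I))
  rw [norm_ofReal_mul_exp_mul_I hr τ] at this
  linarith [hz.2]

lemma zero_mem_closure_sector {r₀ a b : ℝ} (hr₀ : 0 < r₀) (hab : a < b) :
    (0 : ℂ) ∈ closure (sector r₀ a b) := by
  rw [Metric.mem_closure_iff]
  intro ε hε
  have hpos : 0 < min ε r₀ / 2 := by positivity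
  refine ⟨_, ⟨min ε r₀ / 2, (a + b) / 2, hpos, ?_, by linarith, by linarith, rfl⟩, ?_⟩
  · linarith [min_le_right ε r₀]
  · rw [dist_zero_left, norm_ofReal_mul_exp_mul_I hpos]
    linarith [min_le_left ε r₀]

/-- On a sector of opening less than `2π`, a function whose derivative is bounded by `ε` is
Lipschitz with constant proportional to `ε`. -/
lemma exists_norm_sub_le_of_norm_deriv_le_sector {a b : ℝ} (hab : 0 < b - a)
    (hab' : b - a < 2 * Real.pi) :
    ∃ C > 0, ∀ (ρ ε : ℝ) (f f' : ℂ → ℂ), (∀ z ∈ sector ρ a b, HasDerivAt f (f' z) z) →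
      (∀ z ∈ sector ρ a b, ‖f' z‖ ≤ ε) →
      ∀ x ∈ sector ρ a b, ∀ y ∈ sector ρ a b, ‖f x - f y‖ ≤ C * ε * ‖x - y‖ := by
  obtain ⟨s, hs, hchord⟩ := exists_mul_abs_sub_le_norm_exp_sub_exp hab hab'
  refine ⟨1 + 2 / s, by positivity, ?_⟩
  rintro ρ ε f f' hf hf' _ ⟨r, α, hr, hrρ, hα, hα', rfl⟩ _ ⟨t, β, ht, htρ, hβ, hβ', rfl⟩
  have hε : 0 ≤ ε := (norm_nonneg _).trans (hf' _ ⟨r, α, hr, hrρ, hα, hα', rfl⟩)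
  have hradial : ‖f (r * Complex.exp (α * Complex.I)) - f (t * Complex.exp (α * Complex.I))‖
      ≤ ε * |r - t| := by
    refine (convex_Ioo 0 ρ).norm_image_sub_le_of_norm_hasDerivWithin_le
      (f := fun u : ℝ => f (u * Complex.exp (α * Complex.I)))
      (f' := fun u : ℝ => f' (u * Complex.exp (α * Complex.I)) * Complex.exp (α * Complex.I))
      (fun u hu => ?_) (fun u hu => ?_) ⟨ht, htρ⟩ ⟨hr, hrρ⟩
    · have h1 : HasDerivAt (fun u : ℝ => (u : ℂ) * Complex.exp (α * Complex.I))
          (Complex.exp (α * Complex.I)) u := by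
        simpa using (Complex.ofRealCLM.hasDerivAt (x := u)).mul_const (Complex.exp (α * Complex.I))
      exact ((hf _ ⟨u, α, hu.1, hu.2, hα, hα', rfl⟩).comp u h1).hasDerivWithinAt
    · rw [norm_mul, Complex.norm_exp_ofReal_mul_I, mul_one]
      exact hf' _ ⟨u, α, hu.1, hu.2, hα, hα', rfl⟩
  have harc : ‖f (t * Complex.exp (α * Complex.I)) - f (t * Complex.exp (β * Complex.I))‖
      ≤ ε * t * |α - β| := by
    refine (convex_Ioo a b).norm_image_sub_le_of_norm_hasDerivWithin_le
      (f := fun u : ℝ => f (t * Complex.exp (u * Complex.I)))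
      (f' := fun u : ℝ => f' (t * Complex.exp (u * Complex.I)) *
        (t * (Complex.exp (u * Complex.I) * Complex.I)))
      (fun u hu => ?_) (fun u hu => ?_) ⟨hβ, hβ'⟩ ⟨hα, hα'⟩
    · have h1 : HasDerivAt (fun u : ℝ => (t : ℂ) * Complex.exp (u * Complex.I))
          (t * (Complex.exp (u * Complex.I) * Complex.I)) u := by
        have h2 : HasDerivAt (fun u : ℝ => (u : ℂ) * Complex.I) Complex.I u := by
          simpa using (Complex.ofRealCLM.hasDerivAt (x := u)).mul_const Complex.I
        exact h2.cexp.const_mul _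
      exact ((hf _ ⟨t, u, ht, htρ, hu.1, hu.2, rfl⟩).comp u h1).hasDerivWithinAt
    · rw [← mul_assoc (t : ℂ), norm_mul, norm_mul, Complex.norm_I, mul_one,
        norm_ofReal_mul_exp_mul_I ht]
      exact mul_le_mul_of_nonneg_right (hf' _ ⟨t, u, ht, htρ, hu.1, hu.2, rfl⟩) ht.le
  set p := Complex.exp (α * Complex.I) with hp
  set q := Complex.exp (β * Complex.I) with hq
  have hpn : ‖p‖ = 1 := Complex.norm_exp_ofReal_mul_I α
  have hrt : |r - t| ≤ ‖(r : ℂ) * p - t * q‖ := by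
    have := abs_norm_sub_norm_le ((r : ℂ) * p) (t * q)
    rwa [norm_ofReal_mul_exp_mul_I hr, norm_ofReal_mul_exp_mul_I ht] at this
  have hpq : t * ‖p - q‖ ≤ 2 * ‖(r : ℂ) * p - t * q‖ := by
    have h1 : t * ‖p - q‖ = ‖((r : ℂ) * p - t * q) - ((r - t : ℝ) : ℂ) * p‖ := by
      rw [← Real.norm_of_nonneg ht.le, ← Complex.norm_real, ← norm_mul, Complex.norm_real,
        Real.norm_of_nonneg ht.le]
      congr 1
      push_cast
      ring
    have h2 := norm_sub_le ((r : ℂ) * p - t * q) (((r - t : ℝ) : ℂ) * p)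
    rw [norm_mul ((r - t : ℝ) : ℂ), hpn, mul_one, Complex.norm_real, Real.norm_eq_abs] at h2
    linarith
  have hang : t * |α - β| ≤ 2 / s * ‖(r : ℂ) * p - t * q‖ := by
    have h1 := hchord α β (abs_le.2 ⟨by linarith, by linarith⟩)
    have h2 : t * (s * |α - β|) ≤ t * ‖p - q‖ := mul_le_mul_of_nonneg_left h1 ht.le
    rw [div_mul_eq_mul_div, le_div_iff₀ hs]
    linarith
  calc ‖f (r * p) - f (t * q)‖ ≤ ε * |r - t| + ε * t * |α - β| :=
        (norm_sub_le_norm_sub_add_norm_sub _ _ _).trans (add_le_add hradial harc)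
    _ = ε * (|r - t| + t * |α - β|) := by ring
    _ ≤ ε * (‖(r : ℂ) * p - t * q‖ + 2 / s * ‖(r : ℂ) * p - t * q‖) := by gcongr
    _ = _ := by ring

lemma sector_inter_ball_subset {r₀ a b ρ : ℝ} :
    sector r₀ a b ∩ Metric.ball 0 ρ ⊆ sector ρ a b := by
  rintro _ ⟨⟨r, τ, hr, -, ha, hb, rfl⟩, h⟩
  rw [mem_ball_zero_iff, norm_ofReal_mul_exp_mul_I hr] at h
  exact ⟨r, τ, hr, h, ha, hb, rfl⟩

lemma sector_subset_inter_ball {r₀ a b ρ : ℝ} (hρ : ρ ≤ r₀) :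
    sector ρ a b ⊆ sector r₀ a b ∩ Metric.ball 0 ρ := by
  rintro _ ⟨r, τ, hr, h, ha, hb, rfl⟩
  refine ⟨⟨r, τ, hr, h.trans_le hρ, ha, hb, rfl⟩, ?_⟩
  rwa [mem_ball_zero_iff, norm_ofReal_mul_exp_mul_I hr]

/-- If `w' → c` at the apex of a sector, then `w - c z` has arbitrarily small Lipschitz constant
near the apex. -/
lemma exists_norm_sub_sub_le_of_tendsto_deriv {r₀ a b : ℝ} (hr₀ : 0 < r₀) (hab : 0 < b - a)
    (hab' : b - a < 2 * Real.pi) {w : ℂ → ℂ} {c : ℂ} (hw : DifferentiableOn ℂ w (sector r₀ a b))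
    (hw' : Tendsto (deriv w) (𝓝[sector r₀ a b] 0) (𝓝 c)) {κ : ℝ} (hκ : 0 < κ) :
    ∃ ρ > 0, ρ ≤ r₀ ∧ ∀ x ∈ sector ρ a b, ∀ y ∈ sector ρ a b,
      ‖(w x - c * x) - (w y - c * y)‖ ≤ κ * ‖x - y‖ := by
  obtain ⟨C, hC, h⟩ := exists_norm_sub_le_of_norm_deriv_le_sector hab hab'
  have hev := Metric.tendsto_nhds.1 hw' (κ / C) (by positivity)
  obtain ⟨ρ, hρ, hball⟩ := Metric.mem_nhdsWithin_iff.1 hev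
  refine ⟨min ρ r₀, lt_min hρ hr₀, min_le_right _ _, fun x hx y hy => ?_⟩
  have hsub : sector (min ρ r₀) a b ⊆ sector r₀ a b ∩ Metric.ball 0 (min ρ r₀) :=
    sector_subset_inter_ball (min_le_right _ _)
  have := h (min ρ r₀) (κ / C) (fun z => w z - c * z) (fun z => deriv w z - c)
    (fun z hz => by
      have h1 := (hw.differentiableAt ((isOpen_sector r₀ a b).mem_nhds (hsub hz).1)).hasDerivAt
      have h2 : HasDerivAt (fun z : ℂ => c * z) c z := by
        simpa using (hasDerivAt_id z).const_mul c
      exact h1.sub h2)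
    (fun z hz => by
      have h1 := hball ⟨Metric.ball_subset_ball (min_le_left _ _) (hsub hz).2, (hsub hz).1⟩
      rw [← dist_eq_norm]
      exact le_of_lt h1) x hx y hy
  rwa [mul_div_cancel₀ _ hC.ne'] at this


/-- in the cone inverse-function setting, the image of ŵ covers a
scaled copy (by c) of every strict subcone near 0. -/
theorem stmt15 (r₀ τ₁ τ₂ τ₁' τ₂' : ℝ) (hr₀ : 0 < r₀) (hτ : 0 < τ₂ - τ₁)
    (hτ' : τ₂ - τ₁ < 2 * Real.pi) (h₁ : τ₁ < τ₁') (h₂ : τ₁' < τ₂') (h₃ : τ₂' < τ₂)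
    (K K' : Set ℂ)
    (hK : K = {z : ℂ | ∃ r τ : ℝ, 0 < r ∧ r < r₀ ∧ τ₁ < τ ∧ τ < τ₂ ∧
      z = (r : ℂ) * Complex.exp (τ * Complex.I)})
    (hK' : K' = {z : ℂ | ∃ r τ : ℝ, 0 < r ∧ r < r₀ ∧ τ₁' < τ ∧ τ < τ₂' ∧
      z = (r : ℂ) * Complex.exp (τ * Complex.I)})
    (w : ℂ → ℂ) (hw : DifferentiableOn ℂ w K) (c : ℂ) (hc : c ≠ 0)
    (hw0 : Filter.Tendsto w (nhdsWithin 0 K) (nhds 0))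
    (hw' : Filter.Tendsto (deriv w) (nhdsWithin 0 K) (nhds c)) :
    ∃ U ∈ nhds (0 : ℂ), Set.InjOn w (K ∩ U) ∧
      ∃ V ∈ nhds (0 : ℂ), (fun z : ℂ => c * z) '' (K' ∩ V) ⊆ w '' (K ∩ U) := by
  change K = sector r₀ τ₁ τ₂ at hK
  change K' = sector r₀ τ₁' τ₂' at hK'
  subst hK hK'
  obtain ⟨η, hη, hη1, hpolar⟩ := exists_polar_of_norm_sub_le
    (lt_min (sub_pos.2 h₁) (sub_pos.2 h₃))
  have hc' : 0 < ‖c‖ := norm_pos_iff.2 hc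
  have hκ : 0 < ‖c‖ * η / 8 := by positivity
  obtain ⟨ρ, hρ, hρr, hlip⟩ := exists_norm_sub_sub_le_of_tendsto_deriv hr₀ hτ hτ' hw hw' hκ
  have hlower : ∀ x ∈ sector ρ τ₁ τ₂, ∀ y ∈ sector ρ τ₁ τ₂,
      ‖c‖ / 2 * ‖x - y‖ ≤ ‖w x - w y‖ := by
    intro x hx y hy
    have h := hlip x hx y hy
    have h2 : ‖c * (x - y)‖ ≤ ‖w x - w y‖ + ‖(w x - c * x) - (w y - c * y)‖ := by
      refine le_trans (le_of_eq ?_) (norm_sub_le _ _)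
      congr 1
      ring
    rw [norm_mul] at h2
    have h3 : ‖c‖ * η / 8 * ‖x - y‖ ≤ ‖c‖ / 2 * ‖x - y‖ := by
      refine mul_le_mul_of_nonneg_right ?_ (norm_nonneg _)
      nlinarith
    linarith
  have hinj : Set.InjOn w (sector ρ τ₁ τ₂) := by
    intro x hx y hy hxy
    have h := hlower x hx y hy
    rw [hxy, sub_self, norm_zero] at h
    have : ‖x - y‖ ≤ 0 := by
      by_contra! h4
      nlinarith [mul_pos hc' h4]
    exact sub_eq_zero.1 (norm_le_zero_iff.1 this)
  have hsmall : ∀ x ∈ sector ρ τ₁ τ₂, ‖w x - c * x‖ ≤ ‖c‖ * η / 8 * ‖x‖ := by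
    intro x hx
    have hne : (𝓝[sector ρ τ₁ τ₂] (0 : ℂ)).NeBot :=
      mem_closure_iff_nhdsWithin_neBot.1 (zero_mem_closure_sector hρ (sub_pos.1 hτ))
    have hmono : 𝓝[sector ρ τ₁ τ₂] (0 : ℂ) ≤ 𝓝[sector r₀ τ₁ τ₂] 0 :=
      nhdsWithin_mono _ fun z hz => (sector_subset_inter_ball hρr hz).1
    have hid : Tendsto (fun y : ℂ => y) (𝓝[sector ρ τ₁ τ₂] (0 : ℂ)) (𝓝 0) :=
      tendsto_id.mono_left nhdsWithin_le_nhds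
    have hl := (((hw0.mono_left hmono).sub (hid.const_mul c)).const_sub (w x - c * x)).norm
    have hr := ((hid.const_sub x).norm).const_mul (‖c‖ * η / 8)
    simp only [mul_zero, sub_zero] at hl hr
    exact le_of_tendsto_of_tendsto hl hr
      (eventually_nhdsWithin_of_forall fun y hy => hlip x hx y hy)
  refine ⟨Metric.ball 0 ρ, Metric.ball_mem_nhds _ hρ, hinj.mono sector_inter_ball_subset,
    Metric.ball 0 (ρ / 2), Metric.ball_mem_nhds _ (by positivity), ?_⟩
  rintro _ ⟨_, ⟨⟨r, τ, hr, -, hτa, hτb, rfl⟩, hV⟩, rfl⟩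
  rw [mem_ball_zero_iff, norm_ofReal_mul_exp_mul_I hr] at hV
  have hnorm := norm_ofReal_mul_exp_mul_I hr τ
  set ζ : ℂ := (r : ℂ) * Complex.exp (τ * Complex.I) with hζ
  have hηr : 0 < η * r := by positivity
  have hball : Metric.closedBall ζ (η * r) ⊆ sector ρ τ₁ τ₂ := by
    intro z hz
    rw [mem_closedBall_iff_norm] at hz
    obtain ⟨τ', hz0, hτ', hzeq⟩ := hpolar r τ z hr hz
    rw [lt_min_iff, abs_lt, abs_lt] at hτ'
    refine ⟨‖z‖, τ', hz0, ?_, by linarith [hτ'.1.1], by linarith [hτ'.2.2], hzeq⟩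
    have := norm_sub_norm_le z ζ
    nlinarith
  have hζmem : ζ ∈ sector ρ τ₁ τ₂ := hball (Metric.mem_closedBall_self hηr.le)
  have hdiff : DiffContOnCl ℂ w (Metric.ball ζ (η * r)) := by
    refine DifferentiableOn.diffContOnCl (hw.mono ?_)
    rw [closure_ball _ hηr.ne']
    exact fun z hz => (sector_subset_inter_ball hρr (hball hz)).1
  have hfreq : ∃ᶠ z in 𝓝 ζ, w z ≠ w ζ := by
    have hev : ∀ᶠ z in 𝓝[≠] ζ, w z ≠ w ζ := by
      filter_upwards [self_mem_nhdsWithin,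
        mem_nhdsWithin_of_mem_nhds ((isOpen_sector ρ τ₁ τ₂).mem_nhds hζmem)] with z hz hzs heq
      exact hz (hinj hzs hζmem heq)
    exact hev.frequently.filter_mono nhdsWithin_le_nhds
  have himage := hdiff.ball_subset_image_closedBall hηr (ε := ‖c‖ / 2 * (η * r))
    (fun z hz => by
      have h := hlower z (hball (Metric.sphere_subset_closedBall hz)) ζ hζmem
      rwa [mem_sphere_iff_norm.1 hz] at h) hfreq
  obtain ⟨z, hz, hwz⟩ := himage (show c * ζ ∈ _ by
    rw [mem_ball_iff_norm, norm_sub_rev]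
    have h := hsmall ζ hζmem
    rw [hnorm] at h
    nlinarith [mul_pos hc' hηr])
  exact ⟨z, sector_subset_inter_ball hρr (hball hz), hwz⟩
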